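/- Let k ≥ 3, let J be a finite connected k-uniform hypergraph, and let e_0,…,e_t be an allowed edge order of the edges of J in which e_i (for some i ∈ [t]) is the first edge that is bad or k-bad; let P denote the overlapping pair or loose cycle among e_0,…,e_i guaranteed in this situation. Then: (ii) for every connected subhypergraph S of J that contains P, there exists an allowed edge order of the edge set of J that begins with the edges of P, followed by the remaining edges of S, followed by the remaining edges of J; and (iii) if moreover the original edge order e_0,…,e_t is valid and S is itself an overlapping pair or a loose cycle, then the edge order in (ii) can be chosen to be valid. -/

import Mathlib

variable {V : Type*} [DecidableEq V]

/-! ### Hypergraphs, edge orders, and configurations.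
A (finite) hypergraph is represented by its finite set of edges, each edge being a
finite set of vertices; an edge order is a duplicate-free list of edges. -/

/-- The vertex set of a list of edges. -/
def vset (l : List (Finset V)) : Finset V := l.foldr (· ∪ ·) ∅

/-- The set of old vertices of the `i`-th edge of an edge order: those vertices of the
`i`-th edge appearing in some earlier edge. -/
def oldOf (l : List (Finset V)) (i : ℕ) : Finset V := l.getD i ∅ ∩ vset (l.take i)

/-- The `i`-th edge is good: it has exactly one old vertex. -/
def GoodAt (l : List (Finset V)) (i : ℕ) : Prop := (oldOf l i).card = 1

/-- The `i`-th edge is bad: it has between `2` and `k-1` old vertices. -/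
def BadAt (k : ℕ) (l : List (Finset V)) (i : ℕ) : Prop :=
  2 ≤ (oldOf l i).card ∧ (oldOf l i).card ≤ k - 1

/-- The `i`-th edge is `k`-bad: all of its `k` vertices are old. -/
def KBadAt (k : ℕ) (l : List (Finset V)) (i : ℕ) : Prop := (oldOf l i).card = k

/-- An allowed edge order: every non-initial edge is good, bad or `k`-bad, i.e. has at
least one old vertex. -/
def Allowed (l : List (Finset V)) : Prop :=
  l.Nodup ∧ ∀ i, 0 < i → i < l.length → 1 ≤ (oldOf l i).card

/-- A valid edge order: every non-initial edge is good or bad. -/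
def Valid (k : ℕ) (l : List (Finset V)) : Prop :=
  l.Nodup ∧ ∀ i, 0 < i → i < l.length → 1 ≤ (oldOf l i).card ∧ (oldOf l i).card ≤ k - 1

/-- Consecutive edges of the order intersect. -/
def Chain (l : List (Finset V)) : Prop :=
  ∀ i, i + 1 < l.length → (l.getD i ∅ ∩ l.getD (i + 1) ∅).Nonempty

/-- An overlapping pair: two (distinct) edges sharing between `2` and `k-1` vertices. -/
def OverlapPair (k : ℕ) (l : List (Finset V)) : Prop :=
  ∃ e f : Finset V, l = [e, f] ∧ e ≠ f ∧ 2 ≤ (e ∩ f).card ∧ (e ∩ f).card ≤ k - 1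

/-- A loose cycle: at least three edges; cyclically consecutive edges meet in exactly one
vertex and all other pairs of edges are disjoint. -/
def LooseCycle (l : List (Finset V)) : Prop :=
  3 ≤ l.length ∧ l.Nodup ∧
  ∀ i j, i < j → j < l.length →
    (l.getD i ∅ ∩ l.getD j ∅).card =
      if j = i + 1 ∨ (i = 0 ∧ j = l.length - 1) then 1 else 0

/-- A loose path: consecutive edges meet in exactly one vertex and all other pairs of
edges are disjoint. -/
def LoosePath (l : List (Finset V)) : Prop :=
  l ≠ [] ∧ l.Nodup ∧
  ∀ i j, i < j → j < l.length →
    (l.getD i ∅ ∩ l.getD j ∅).card = if j = i + 1 then 1 else 0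

/-- An overlapping pair or a loose cycle. -/
def OPorLC (k : ℕ) (l : List (Finset V)) : Prop := OverlapPair k l ∨ LooseCycle l

/-- A spoiled cycle. -/
def SpoiledCycle (k : ℕ) (l : List (Finset V)) : Prop :=
  Valid k l ∧ Chain l ∧
  ∃ (e₁ e₂ : Finset V) (P₂ : List (Finset V)),
    l = e₁ :: e₂ :: P₂ ∧ OverlapPair k [e₁, e₂] ∧ LoosePath P₂ ∧
    ∃ x y : V, x ≠ y ∧
      vset [e₁, e₂] ∩ vset P₂ = {x, y} ∧
      (e₂ \ e₁) ∩ (P₂.getD 0 ∅ \ (if 2 ≤ P₂.length then P₂.getD 1 ∅ else e₁)) = {x} ∧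
      (e₁ \ e₂) ∩ (P₂.getD (P₂.length - 1) ∅ \
        (if 2 ≤ P₂.length then P₂.getD (P₂.length - 2) ∅ else e₂)) = {y}

/-- A double loose cycle. -/
def DoubleLooseCycle (k : ℕ) (l : List (Finset V)) : Prop :=
  Valid k l ∧ Chain l ∧
  ∃ P₁ P₂ : List (Finset V),
    l = P₁ ++ P₂ ∧ LooseCycle P₁ ∧ LoosePath P₂ ∧ 2 ≤ P₂.length ∧
    ∃ x y : V, x ≠ y ∧
      vset P₁ ∩ vset P₂ = {x, y} ∧
      (P₂.getD 0 ∅ \ P₂.getD 1 ∅) ∩ P₁.getD (P₁.length - 1) ∅ = {x} ∧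
      ∃ a < P₁.length, (P₂.getD (P₂.length - 1) ∅ \ P₂.getD (P₂.length - 2) ∅) ∩
        P₁.getD a ∅ = {y}

/-- A double overlapping pair. -/
def DoubleOverlapPair (k : ℕ) (l : List (Finset V)) : Prop :=
  Valid k l ∧ Chain l ∧
  ∃ e₁ e₂ e₃ e₄ : Finset V,
    l = [e₁, e₂, e₃, e₄] ∧ OverlapPair k [e₁, e₂] ∧ OverlapPair k [e₃, e₄] ∧
    (e₃ ∩ e₄).card ≤ k - 2 ∧
    ∃ x y : V, x ≠ y ∧
      vset [e₁, e₂] ∩ vset [e₃, e₄] = {x, y} ∧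
      (e₁ \ e₂) ∩ (e₄ \ e₃) = {x} ∧ (e₂ \ e₁) ∩ (e₃ \ e₄) = {y}

/-- An overlapping pair/loose cycle with handle. -/
def WithHandle (k : ℕ) (l : List (Finset V)) : Prop :=
  Valid k l ∧ Chain l ∧
  ∃ (l' : List (Finset V)) (e : Finset V),
    l = l' ++ [e] ∧ OPorLC k l' ∧ BadAt k l (l.length - 1)

/-- An overlapping pair/loose cycle to overlapping pair/loose cycle. -/
def CycleToCycle (k : ℕ) (l : List (Finset V)) : Prop :=
  Valid k l ∧ Chain l ∧
  ∃ P₁ P₂ P₃ : List (Finset V),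
    l = P₁ ++ P₂ ++ P₃ ∧ OPorLC k P₁ ∧ OPorLC k P₃ ∧
    ((P₂ = [] ∧ (vset P₁ ∩ vset P₃).card = 1) ∨
     (P₂ ≠ [] ∧ LoosePath P₂ ∧
       (vset P₁ ∩ vset P₂).card = 1 ∧ vset P₁ ∩ vset P₃ = ∅ ∧
       (vset P₂ ∩ vset P₃).card = 1 ∧
       (2 ≤ P₂.length →
         P₂.getD 1 ∅ ∩ vset P₁ = ∅ ∧ P₂.getD (P₂.length - 2) ∅ ∩ vset P₃ = ∅)))

/-- A bicycle. -/
def Bicycle (k : ℕ) (l : List (Finset V)) : Prop :=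
  SpoiledCycle k l ∨ DoubleOverlapPair k l ∨ DoubleLooseCycle k l ∨
    WithHandle k l ∨ CycleToCycle k l

/-- The hypergraph with edge set `E` contains a bicycle: some of its edges, under some
edge order, form one. -/
def ContainsBicycle (k : ℕ) (E : Finset (Finset V)) : Prop :=
  ∃ l : List (Finset V), l.toFinset ⊆ E ∧ Bicycle k l

/-- A Pasch configuration (for `k = 3`): four edges spanning six vertices, each vertex
lying in exactly two of the edges, one vertex for each of the six pairs of edges. -/
def Pasch (l : List (Finset V)) : Prop :=
  Allowed l ∧ l.length = 4 ∧ (vset l).card = 6 ∧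
  (∀ v ∈ vset l, ((Finset.range 4).filter fun i => v ∈ l.getD i ∅).card = 2) ∧
  ∀ i j, i < j → j < 4 → (l.getD i ∅ ∩ l.getD j ∅).card = 1

/-- A loose star with centre `c`: edges pairwise disjoint except for the common central
vertex `c`. -/
def LooseStar (l : List (Finset V)) (c : V) : Prop :=
  l ≠ [] ∧ l.Nodup ∧ (∀ e ∈ l, c ∈ e) ∧
  ∀ i j, i < j → j < l.length → l.getD i ∅ ∩ l.getD j ∅ = {c}

/-- A `(k,u,2)`-star: `2u` edges forming two loose `u`-stars whose edges are matched up so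
that matched edges share all their vertices except the two centres. -/
def StarKU2 (k u : ℕ) (l : List (Finset V)) : Prop :=
  Allowed l ∧ l.length = 2 * u ∧
  ∃ (c₁ c₂ : V) (l₁ l₂ : List (Finset V)),
    c₁ ≠ c₂ ∧ l₁.length = u ∧ l₂.length = u ∧
    (l₁ ++ l₂).Perm l ∧ LooseStar l₁ c₁ ∧ LooseStar l₂ c₂ ∧
    ∀ i < u, (l₁.getD i ∅).erase c₁ = (l₂.getD i ∅).erase c₂

/-- A `(k,u,a)`-link: `u` edges spanning `k+a` vertices, any two of which together contain
all `k+a` vertices. -/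
def KLink (k u a : ℕ) (l : List (Finset V)) : Prop :=
  Allowed l ∧ l.length = u ∧ (vset l).card = k + a ∧
  ∀ i j, i < j → j < u → (l.getD i ∅ ∪ l.getD j ∅).card = k + a

/-- The hypergraph with edge set `E` is connected. -/
def HyperConnected (E : Finset (Finset V)) : Prop :=
  ∀ F ⊆ E, F.Nonempty → (E \ F).Nonempty → ∃ e ∈ F, ∃ f ∈ E \ F, (e ∩ f).Nonempty

/-- The hypergraph with edge set `E` is `k`-uniform. -/
def Uniform (k : ℕ) (E : Finset (Finset V)) : Prop := ∀ e ∈ E, e.card = k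

/-! ### Helper lemmas -/


theorem mem_vset {l : List (Finset V)} {v : V} : v ∈ vset l ↔ ∃ e ∈ l, v ∈ e := by
  induction l with
  | nil => simp [vset]
  | cons a l ih =>
    have : vset (a :: l) = a ∪ vset l := rfl
    rw [this, Finset.mem_union, ih]; simp

theorem vset_append (a b : List (Finset V)) : vset (a ++ b) = vset a ∪ vset b := by
  ext v; simp only [mem_vset, Finset.mem_union, List.mem_append]
  constructor
  · rintro ⟨e, h | h, hv⟩
    · exact Or.inl ⟨e, h, hv⟩
    · exact Or.inr ⟨e, h, hv⟩
  · rintro (⟨e, h, hv⟩ | ⟨e, h, hv⟩)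
    · exact ⟨e, Or.inl h, hv⟩
    · exact ⟨e, Or.inr h, hv⟩

theorem vset_congr {a b : List (Finset V)} (h : ∀ e, e ∈ a ↔ e ∈ b) : vset a = vset b := by
  ext v; simp only [mem_vset, h]

theorem vset_single (f : Finset V) : vset [f] = f := by
  ext v; simp [mem_vset]

/-- Every edge after the first one has a number of old vertices satisfying `Q`. -/
def OldOrd (Q : ℕ → Prop) (l : List (Finset V)) : Prop :=
  ∀ a f b, l = a ++ f :: b → a ≠ [] → Q (f ∩ vset a).card

theorem ord_iff (Q : ℕ → Prop) (l : List (Finset V)) :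
    (∀ i, 0 < i → i < l.length → Q (oldOf l i).card) ↔ OldOrd Q l := by
  constructor
  · rintro h a f b rfl ha
    have := h a.length (List.length_pos_iff.2 ha) (by simp)
    simpa [oldOf] using this
  · intro h i hi hil
    have := h (l.take i) l[i] (l.drop (i+1)) (by simp) (by
      intro h0
      have := congrArg List.length h0
      simp at this; rcases this with h1 | h1
      · omega
      · simp [h1] at hil)
    rw [oldOf, List.getD_eq_getElem _ _ hil]; exact this

theorem allowed_iff (l : List (Finset V)) : Allowed l ↔ l.Nodup ∧ OldOrd (fun n => 1 ≤ n) l := by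
  unfold Allowed; rw [← ord_iff]

theorem valid_iff (k : ℕ) (l : List (Finset V)) :
    Valid k l ↔ l.Nodup ∧ OldOrd (fun n => 1 ≤ n ∧ n ≤ k - 1) l := by
  unfold Valid; rw [← ord_iff]

theorem ord_append {Q : ℕ → Prop} {x y : List (Finset V)} (hx : x ≠ []) :
    OldOrd Q (x ++ y) ↔ OldOrd Q x ∧ ∀ a f b, y = a ++ f :: b → Q (f ∩ vset (x ++ a)).card := by
  constructor
  · intro h
    refine ⟨?_, ?_⟩
    · rintro a f b rfl ha
      exact h a f (b ++ y) (by simp) ha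
    · rintro a f b rfl
      exact h (x ++ a) f b (by simp) (by simp [hx])
  · rintro ⟨h1, h2⟩ a f b hab ha
    rcases List.append_eq_append_iff.1 hab with ⟨c, rfl, h⟩ | ⟨c, rfl, h⟩
    · exact h2 c f b h
    · cases c with
      | nil =>
        have := h2 [] f b (by simpa using h.symm)
        simpa using this
      | cons g c =>
        simp only [List.cons_append, List.cons.injEq] at h
        obtain ⟨rfl, rfl⟩ := h
        exact h1 a f c rfl ha

theorem ord_snoc {Q : ℕ → Prop} {x : List (Finset V)} {g : Finset V} (hx : x ≠ []) :
    OldOrd Q (x ++ [g]) ↔ OldOrd Q x ∧ Q (g ∩ vset x).card := by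
  rw [ord_append hx]
  refine and_congr_right fun _ => ⟨fun h => by simpa using h [] g [] rfl, ?_⟩
  rintro h a f b hab
  cases a with
  | nil => simp at hab; obtain ⟨rfl, rfl⟩ := hab; simpa using h
  | cons c a => simp at hab

theorem ord_single (Q : ℕ → Prop) (g : Finset V) : OldOrd Q [g] := by
  rintro a f b hab ha
  cases a with
  | nil => exact absurd rfl ha
  | cons c a => simp at hab

theorem ord_mono {Q R : ℕ → Prop} (h : ∀ n, Q n → R n) {l : List (Finset V)} (hl : OldOrd Q l) :
    OldOrd R l := fun a f b hab ha => h _ (hl a f b hab ha)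

theorem inter_vset_pos {f g : Finset V} {a : List (Finset V)} (hg : g ∈ a)
    (h : (g ∩ f).Nonempty) : 1 ≤ (f ∩ vset a).card := by
  obtain ⟨v, hv⟩ := h
  rw [Finset.mem_inter] at hv
  exact Finset.card_pos.2 ⟨v, Finset.mem_inter.2 ⟨hv.2, mem_vset.2 ⟨g, hg, hv.1⟩⟩⟩

/-- Greedy extension. -/
theorem extend_conn (S : Finset (Finset V)) (hS : HyperConnected S) :
    ∀ (n : ℕ) (m : List (Finset V)), (S \ m.toFinset).card = n → m ≠ [] → m.Nodup →
      OldOrd (fun n => 1 ≤ n) m → m.toFinset ⊆ S →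
      ∃ r, (m ++ r).Nodup ∧ OldOrd (fun n => 1 ≤ n) (m ++ r) ∧ (m ++ r).toFinset = S := by
  intro n
  induction n with
  | zero =>
    intro m hn hm hnd ho hsub
    refine ⟨[], by simpa, by simpa, ?_⟩
    rw [Finset.card_eq_zero, Finset.sdiff_eq_empty_iff_subset] at hn
    simpa using Finset.Subset.antisymm hsub hn
  | succ n ih =>
    intro m hn hm hnd ho hsub
    obtain ⟨e, he, f, hf, hef⟩ := hS m.toFinset hsub
      (by obtain ⟨x, hx⟩ := List.exists_mem_of_ne_nil m hm; exact ⟨x, by simpa using hx⟩)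
      (Finset.card_pos.1 (by omega))
    have hf' := Finset.mem_sdiff.1 hf
    have hfm : f ∉ m := by simpa using hf'.2
    have heq : (m ++ [f]).toFinset = insert f m.toFinset := by ext; simp [or_comm]
    obtain ⟨r, h1, h2, h3⟩ := ih (m ++ [f])
      (by
        rw [heq, Finset.sdiff_insert, Finset.card_erase_of_mem hf]; omega)
      (by simp)
      (by rw [List.nodup_append]; refine ⟨hnd, by simp, ?_⟩
          rintro a ha b hb rfl; simp at hb; exact hfm (hb ▸ ha))
      ((ord_snoc hm).2 ⟨ho, inter_vset_pos (by simpa using he) hef⟩)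
      (by rw [heq]; exact Finset.insert_subset hf'.1 hsub)
    exact ⟨f :: r, by simpa using h1, by simpa using h2, by simpa using h3⟩

theorem conn_of_ord_aux (F : Finset (Finset V)) (l : List (Finset V)) :
    OldOrd (fun n => 1 ≤ n) l → (∀ e ∈ l, ∀ f ∈ l, e ∈ F → f ∉ F → ¬ (e ∩ f).Nonempty) →
      (∀ e ∈ l, e ∈ F) ∨ (∀ e ∈ l, e ∉ F) := by
  induction l using List.reverseRecOn with
  | nil => intro _ _; left; simp
  | append_singleton a f ih =>
    intro ho hc
    by_cases ha : a = []
    · subst ha; simp [em]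
    rw [ord_snoc ha] at ho
    obtain ⟨v, hv⟩ := Finset.card_pos.1 (show 0 < _ from ho.2)
    rw [Finset.mem_inter, mem_vset] at hv
    obtain ⟨hvf, g, hg, hvg⟩ := hv
    have h1 := hc g (by simp [hg]) f (by simp)
    have h2 := hc f (by simp) g (by simp [hg])
    have n1 : (g ∩ f).Nonempty := ⟨v, by simp [hvf, hvg]⟩
    have n2 : (f ∩ g).Nonempty := ⟨v, by simp [hvf, hvg]⟩
    rcases ih ho.1 (fun e he f' hf' => hc e (by simp [he]) f' (by simp [hf'])) with h | h
    · left; intro e he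
      rcases List.mem_append.1 he with he | he
      · exact h e he
      · simp at he; subst he
        by_contra hn; exact h1 (h g hg) hn n1
    · right; intro e he
      rcases List.mem_append.1 he with he | he
      · exact h e he
      · simp at he; subst he
        intro hn; exact h2 hn (h g hg) n2

theorem conn_of_ord {l : List (Finset V)} (h : OldOrd (fun n => 1 ≤ n) l) :
    HyperConnected l.toFinset := by
  rintro F hF ⟨e, he⟩ ⟨f, hf⟩
  by_contra hcon
  push Not at hcon
  rw [Finset.mem_sdiff] at hf
  rcases conn_of_ord_aux F l h (by
    intro e _ f hf he hfF hn
    have := hcon e he f (by simp [hf, hfF])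
    rw [this] at hn
    exact Finset.not_nonempty_empty hn) with h' | h'
  · exact hf.2 (h' f (by simpa using hf.1))
  · exact h' e (by simpa using hF he) he

/-! Counting vertices. -/

theorem card_vset_snoc {c : ℕ} {a : List (Finset V)} {f : Finset V} (hf : f.card = c + 1) :
    (vset (a ++ [f])).card + (f ∩ vset a).card = (vset a).card + (c + 1) := by
  rw [vset_append, vset_single, ← hf, Finset.inter_comm]
  exact Finset.card_union_add_card_inter _ _

theorem count_le {c : ℕ} {a : List (Finset V)} (ha : a ≠ []) (b : List (Finset V)) :
    (∀ e ∈ b, e.card = c + 1) → OldOrd (fun n => 1 ≤ n) (a ++ b) →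
      (vset (a ++ b)).card ≤ (vset a).card + b.length * c := by
  induction b using List.reverseRecOn with
  | nil => simp
  | append_singleton b f ih =>
    intro hu ho
    rw [← List.append_assoc] at ho ⊢
    rw [ord_snoc (by simp [ha])] at ho
    have := ih (fun e he => hu e (by simp [he])) ho.1
    have h2 := card_vset_snoc (a := a ++ b) (hu f (by simp))
    have h3 := ho.2
    simp only [List.length_append, List.length_singleton, add_mul, one_mul]
    omega

theorem count_eq {c : ℕ} {a : List (Finset V)} (ha : a ≠ []) (b : List (Finset V)) :
    (∀ e ∈ b, e.card = c + 1) → OldOrd (fun n => n = 1) (a ++ b) →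
      (vset (a ++ b)).card = (vset a).card + b.length * c := by
  induction b using List.reverseRecOn with
  | nil => simp
  | append_singleton b f ih =>
    intro hu ho
    rw [← List.append_assoc] at ho ⊢
    rw [ord_snoc (by simp [ha])] at ho
    have := ih (fun e he => hu e (by simp [he])) ho.1
    have h2 := card_vset_snoc (a := a ++ b) (hu f (by simp))
    have h3 := ho.2
    simp only [List.length_append, List.length_singleton, add_mul, one_mul]
    omega

/-- If some order of a hypergraph has only good edges then so does every allowed order. -/
theorem all_good {c : ℕ} {l m : List (Finset V)} (hlm : l.Perm m)
    (hu : ∀ e ∈ l, e.card = c + 1) (hl : OldOrd (fun n => n = 1) l)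
    (hm : OldOrd (fun n => 1 ≤ n) m) : OldOrd (fun n => n = 1) m := by
  rintro a f b rfl ha
  obtain ⟨g, a, rfl⟩ := List.exists_cons_of_ne_nil ha
  have hum : ∀ e ∈ (g :: a) ++ f :: b, e.card = c + 1 := fun e he => hu e (hlm.mem_iff.2 he)
  have hV : vset l = vset ((g :: a) ++ f :: b) := vset_congr fun e => hlm.mem_iff
  have hlen := hlm.length_eq
  obtain ⟨h, t, rfl⟩ : ∃ h t, l = h :: t := by
    cases l with
    | nil => simp at hlen
    | cons h t => exact ⟨h, t, rfl⟩
  have e1 := count_eq (a := [h]) (by simp) t (fun e he => hu e (by simp [he])) hl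
  have hm' : OldOrd (fun n => 1 ≤ n) (((g :: a) ++ [f]) ++ b) := by simpa using hm
  have e2 := count_le (by simp) b (fun e he => hum e (by simp [he])) hm'
  have hm2 := ((ord_append (by simp)).1 hm').1
  have hm3 := (ord_snoc (by simp)).1 hm2
  have e3 := card_vset_snoc (a := g :: a) (hum f (by simp))
  have e4 := count_le (a := [g]) (by simp) a (fun e he => hum e (by simp [he])) hm3.1
  rw [vset_single] at e1 e4
  have hc1 := hu h (by simp)
  have hc2 := hum g (by simp)
  have h5 : (vset ([h] ++ t)).card = (vset (g :: a ++ [f] ++ b)).card := by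
    rw [show [h] ++ t = h :: t from rfl, hV]; simp
  simp only [List.length_cons, List.length_append] at hlen
  have h6 : t.length = a.length + 1 + b.length := by omega
  rw [h6] at e1
  simp only [add_mul, one_mul] at e1
  have h7 := hm3.2
  have h8 : [g] ++ a = g :: a := rfl
  rw [h8] at e4
  show (f ∩ vset (g :: a)).card = 1
  have h7' : 1 ≤ (f ∩ vset (g :: a)).card := h7
  omega

/-! Loose cycles and overlapping pairs. -/

theorem valid_P {k : ℕ} (hk : 3 ≤ k) {P : List (Finset V)}
    (hP : OverlapPair k P ∨ LooseCycle P) : Valid k P := by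
  rcases hP with ⟨e, f, rfl, hef, h1, h2⟩ | ⟨h3, hnd, hc⟩
  · rw [valid_iff]
    refine ⟨by simp [hef], ?_⟩
    refine (ord_snoc (x := [e]) (by simp)).2 ⟨ord_single _ _, ?_⟩
    rw [vset_single, Finset.inter_comm]; omega
  · refine ⟨hnd, fun p hp hpl => ⟨?_, ?_⟩⟩
    · have := hc (p - 1) p (by omega) hpl
      rw [if_pos (by omega)] at this
      refine inter_vset_pos (g := P.getD (p - 1) ∅) ?_ (Finset.card_pos.1 (by omega))
      rw [List.getD_eq_getElem _ _ (by omega : p - 1 < P.length), List.mem_take_iff_getElem]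
      exact ⟨p - 1, by omega, rfl⟩
    · have hsub : oldOf P p ⊆ (P.getD (p-1) ∅ ∩ P.getD p ∅) ∪ (P.getD 0 ∅ ∩ P.getD p ∅) := by
        intro v hv
        rw [oldOf, Finset.mem_inter, mem_vset] at hv
        obtain ⟨hv, g, hg, hvg⟩ := hv
        obtain ⟨j, hj, rfl⟩ := List.mem_take_iff_getElem.1 hg
        have hj1 : j < p := by omega
        have hcj := hc j p hj1 hpl
        have : v ∈ P.getD j ∅ ∩ P.getD p ∅ := by
          rw [Finset.mem_inter, List.getD_eq_getElem _ _ (by omega : j < P.length)]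
          exact ⟨hvg, hv⟩
        have hpos : 0 < (P.getD j ∅ ∩ P.getD p ∅).card := Finset.card_pos.2 ⟨v, this⟩
        have : p = j + 1 ∨ (j = 0 ∧ p = P.length - 1) := by
          by_contra hn; rw [if_neg hn] at hcj; omega
        rcases this with h | h
        · obtain rfl : j = p - 1 := by omega
          exact Finset.mem_union_left _ ‹_›
        · obtain rfl : j = 0 := h.1
          exact Finset.mem_union_right _ ‹_›
      have c1 := hc (p-1) p (by omega) hpl
      have c2 := hc 0 p (by omega) hpl
      have c1' : (P.getD (p-1) ∅ ∩ P.getD p ∅).card ≤ 1 := by rw [c1]; split_ifs <;> omega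
      have c2' : (P.getD 0 ∅ ∩ P.getD p ∅).card ≤ 1 := by rw [c2]; split_ifs <;> omega
      have := (Finset.card_le_card hsub).trans (Finset.card_union_le _ _)
      omega

theorem ord_of_isChain (m : List (Finset V))
    (h : m.IsChain (fun e f => (e ∩ f).Nonempty)) : OldOrd (fun n => 1 ≤ n) m := by
  rintro a f b rfl ha
  obtain ⟨a', g, rfl⟩ := List.eq_nil_or_concat a |>.resolve_left ha
  have := (List.isChain_append.1 h).2.2 g (by simp) f (by simp)
  exact inter_vset_pos (by simp) this

theorem remove_P {k : ℕ} {P : List (Finset V)}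
    (hP : OverlapPair k P ∨ LooseCycle P) {e : Finset V} (he : e ∈ P) :
    ∃ A, A ≠ [] ∧ P.Perm (e :: A) ∧ OldOrd (fun n => 1 ≤ n) A ∧ (e ∩ vset A).Nonempty := by
  rcases hP with ⟨x, y, rfl, hxy, h1, h2⟩ | ⟨h3, hnd, hc⟩
  · have hne : (x ∩ y).Nonempty := Finset.card_pos.1 (by omega)
    simp at he
    rcases he with rfl | rfl
    · exact ⟨[y], by simp, .refl _, ord_single _ _, by rwa [vset_single]⟩
    · exact ⟨[x], by simp, .swap _ _ _, ord_single _ _, by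
        rwa [vset_single, Finset.inter_comm]⟩
  · have hcons : ∀ j, j + 1 < P.length → (P.getD j ∅ ∩ P.getD (j+1) ∅).Nonempty := by
      intro j hj
      have := hc j (j+1) (by omega) hj
      rw [if_pos (by omega)] at this
      exact Finset.card_pos.1 (by omega)
    have hwrap : (P.getD 0 ∅ ∩ P.getD (P.length - 1) ∅).Nonempty := by
      have := hc 0 (P.length - 1) (by omega) (by omega)
      rw [if_pos (by omega)] at this
      exact Finset.card_pos.1 (by omega)
    have hchain : P.IsChain (fun e f => (e ∩ f).Nonempty) := by
      rw [List.isChain_iff_getElem]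
      intro j hj
      have := hcons j hj
      rwa [List.getD_eq_getElem _ _ hj, List.getD_eq_getElem _ _ (by omega : j < P.length)] at this
    obtain ⟨P₁, P₂, rfl⟩ := List.append_of_mem he
    have hch := List.isChain_append.1 hchain
    have hch2 : P₂.IsChain (fun e f => (e ∩ f).Nonempty) := by
      have := hch.2.1
      rw [show e :: P₂ = [e] ++ P₂ from rfl, List.isChain_append] at this
      exact this.2.1
    refine ⟨P₂ ++ P₁, ?_, ?_, ?_, ?_⟩
    · intro h; simp at h; obtain ⟨rfl, rfl⟩ := h; simp at h3
    · exact List.perm_middle.trans (List.Perm.cons _ List.perm_append_comm)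
    · apply ord_of_isChain
      refine List.isChain_append.2 ⟨hch2, hch.1, ?_⟩
      intro x hx y hy
      obtain ⟨Q, rfl⟩ : ∃ Q, P₂ = Q ++ [x] := by
        rw [Option.mem_def, List.getLast?_eq_some_iff] at hx; exact hx
      obtain ⟨R, rfl⟩ : ∃ R, P₁ = y :: R := by
        rw [Option.mem_def, List.head?_eq_some_iff] at hy; exact hy
      rw [Finset.inter_comm]
      rw [List.getD_eq_getElem _ _ (by simp : 0 < _), List.getD_eq_getElem _ _ (by simp)] at hwrap
      rw [← List.getLast_eq_getElem (by simp)] at hwrap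
      simpa using hwrap
    · rcases P₂ with _ | ⟨g, Q⟩
      · have hne : P₁ ≠ [] := by rintro rfl; simp at h3
        obtain ⟨a', g, rfl⟩ := List.eq_nil_or_concat P₁ |>.resolve_left hne
        have := hch.2.2 g (by simp) e (by simp)
        exact Finset.card_pos.1 (inter_vset_pos (by simp) this)
      · have := (List.isChain_cons_cons.1 hch.2.1).1
        rw [Finset.inter_comm] at this
        exact Finset.card_pos.1 (inter_vset_pos (by simp) this)

theorem lc_adj {s : List (Finset V)} (h : LooseCycle s) {a b : ℕ} (ha : a < s.length)
    (hb : b < s.length) (hab : a ≠ b) (hn : (s.getD a ∅ ∩ s.getD b ∅).Nonempty) :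
    b = a + 1 ∨ a = b + 1 ∨ (a = 0 ∧ b = s.length - 1) ∨ (b = 0 ∧ a = s.length - 1) := by
  have hpos := Finset.card_pos.2 hn
  rcases Nat.lt_or_gt_of_ne hab with hlt | hlt
  · have := h.2.2 a b hlt hb
    by_contra hcon
    rw [if_neg (by omega)] at this; omega
  · have := h.2.2 b a hlt ha
    rw [Finset.inter_comm] at this
    by_contra hcon
    rw [if_neg (by omega)] at this; omega

theorem lc_nonempty {s : List (Finset V)} (h : LooseCycle s) {a b : ℕ} (hab : a < b)
    (hb : b < s.length) (hd : b = a + 1 ∨ (a = 0 ∧ b = s.length - 1)) :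
    (s.getD a ∅ ∩ s.getD b ∅).Nonempty := by
  have := h.2.2 a b hab hb
  rw [if_pos hd] at this
  exact Finset.card_pos.1 (by omega)

theorem getD_inj {s : List (Finset V)} (h : s.Nodup) {a b : ℕ} (ha : a < s.length)
    (hb : b < s.length) (hab : s.getD a ∅ = s.getD b ∅) : a = b := by
  rw [List.getD_eq_getElem _ _ ha, List.getD_eq_getElem _ _ hb] at hab
  exact (List.Nodup.getElem_inj_iff h).1 hab

theorem exists_getD {s : List (Finset V)} {e : Finset V} (h : e ∈ s) :
    ∃ a < s.length, s.getD a ∅ = e := by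
  obtain ⟨a, ha, rfl⟩ := List.getElem_of_mem h
  exact ⟨a, ha, List.getD_eq_getElem _ _ ha⟩

theorem getD_mem' {s : List (Finset V)} {a : ℕ} (ha : a < s.length) : s.getD a ∅ ∈ s := by
  rw [List.getD_eq_getElem _ _ ha]; exact List.getElem_mem ha

/-- Each edge of a loose cycle has two distinct neighbours. -/
theorem lc_two {P : List (Finset V)} (h : LooseCycle P) {e : Finset V} (he : e ∈ P) :
    ∃ x ∈ P, ∃ y ∈ P, x ≠ y ∧ x ≠ e ∧ y ≠ e ∧ (e ∩ x).Nonempty ∧ (e ∩ y).Nonempty := by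
  obtain ⟨a, ha, rfl⟩ := exists_getD he
  have h3 := h.1
  have key : ∃ b c, b < P.length ∧ c < P.length ∧ b ≠ c ∧ b ≠ a ∧ c ≠ a ∧
      (P.getD a ∅ ∩ P.getD b ∅).Nonempty ∧ (P.getD a ∅ ∩ P.getD c ∅).Nonempty := by
    rcases Nat.eq_zero_or_pos a with rfl | h0
    · exact ⟨1, P.length - 1, by omega, by omega, by omega, by omega, by omega,
        lc_nonempty h (by omega) (by omega) (by omega),
        lc_nonempty h (by omega) (by omega) (by omega)⟩
    · by_cases hl : a = P.length - 1
      · refine ⟨0, a - 1, by omega, by omega, by omega, by omega, by omega, ?_, ?_⟩ <;>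
          rw [Finset.inter_comm] <;>
          exact lc_nonempty h (by omega) (by omega) (by omega)
      · refine ⟨a - 1, a + 1, by omega, by omega, by omega, by omega, by omega, ?_, ?_⟩
        · rw [Finset.inter_comm]
          exact lc_nonempty h (by omega) (by omega) (by omega)
        · exact lc_nonempty h (by omega) (by omega) (by omega)
  obtain ⟨b, c, hb, hc, hbc, hba, hca, h1, h2⟩ := key
  exact ⟨_, getD_mem' hb, _, getD_mem' hc, fun hh => hbc (getD_inj h.2.1 hb hc hh),
    fun hh => hba (getD_inj h.2.1 hb ha hh), fun hh => hca (getD_inj h.2.1 hc ha hh), h1, h2⟩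

theorem P_eq_S {k : ℕ} {P s : List (Finset V)}
    (hP : OverlapPair k P ∨ LooseCycle P) (hs : OverlapPair k s ∨ LooseCycle s)
    (hconn : HyperConnected s.toFinset) (hsub : P.toFinset ⊆ s.toFinset) :
    P.toFinset = s.toFinset := by
  rcases hs with ⟨x, y, rfl, hxy, h1, h2⟩ | hs
  · refine Finset.eq_of_subset_of_card_le hsub ?_
    have hc : ([x, y] : List (Finset V)).toFinset.card ≤ 2 := List.toFinset_card_le _
    have : 2 ≤ P.toFinset.card := by
      rcases hP with ⟨e, f, rfl, hef, -⟩ | ⟨h3, hnd, -⟩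
      · rw [List.toFinset_card_of_nodup (by simp [hef])]; simp
      · rw [List.toFinset_card_of_nodup hnd]; omega
    omega
  · rcases hP with ⟨e, f, rfl, hef, h1, h2⟩ | hP
    · exfalso
      have he : e ∈ s := by simpa using hsub (show e ∈ [e, f].toFinset by simp)
      have hf : f ∈ s := by simpa using hsub (show f ∈ [e, f].toFinset by simp)
      obtain ⟨a, ha, rfl⟩ := exists_getD he
      obtain ⟨b, hb, rfl⟩ := exists_getD hf
      have hab : a ≠ b := by rintro rfl; exact hef rfl
      rcases Nat.lt_or_gt_of_ne hab with hlt | hlt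
      · have := hs.2.2 a b hlt hb
        split_ifs at this <;> omega
      · have := hs.2.2 b a hlt ha
        rw [Finset.inter_comm] at this
        split_ifs at this <;> omega
    · by_contra hne
      have hne2 : (s.toFinset \ P.toFinset).Nonempty := by
        rw [Finset.nonempty_iff_ne_empty]
        intro h0
        exact hne (Finset.Subset.antisymm hsub (Finset.sdiff_eq_empty_iff_subset.1 h0))
      obtain ⟨e, he, f, hf, hef⟩ := hconn P.toFinset hsub
        ⟨P.getD 0 ∅, by simpa using getD_mem' (s := P) (a := 0) (by have := hP.1; omega)⟩ hne2
      have he' : e ∈ P := by simpa using he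
      rw [Finset.mem_sdiff] at hf
      obtain ⟨x, hx, y, hy, hxy, hxe, hye, hex, hey⟩ := lc_two hP he'
      have hin : ∀ z ∈ P, z ∈ s := fun z hz => by
        simpa using hsub (show z ∈ P.toFinset by simpa using hz)
      have hfP : f ∉ P := by simpa using hf.2
      obtain ⟨a, ha, rfl⟩ := exists_getD (hin e he')
      obtain ⟨b, hb, rfl⟩ := exists_getD (hin x hx)
      obtain ⟨c, hc, rfl⟩ := exists_getD (hin y hy)
      obtain ⟨d, hd, rfl⟩ := exists_getD (show f ∈ s by simpa using hf.1)
      have n1 : a ≠ b := by rintro rfl; exact hxe rfl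
      have n2 : a ≠ c := by rintro rfl; exact hye rfl
      have n3 : b ≠ c := by rintro rfl; exact hxy rfl
      have n4 : a ≠ d := by rintro rfl; exact hfP he'
      have n5 : b ≠ d := by rintro rfl; exact hfP hx
      have n6 : c ≠ d := by rintro rfl; exact hfP hy
      have := hs.1
      have a1 := lc_adj hs ha hb n1 hex
      have a2 := lc_adj hs ha hc n2 hey
      have a3 := lc_adj hs ha hd n4 hef
      omega

/-- Claim 3.5(ii),(iii) of the paper. With the hypotheses of
Claim 3.5(i), let `P` be the overlapping pair or loose cycle (containing `e_i`) guaranteed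
there. Then (ii) for every connected subhypergraph `S` of `J` containing `P` there is an
allowed edge order of `E(J)` starting with `P`, followed by the remaining edges of `S`,
followed by the remaining edges of `J`; and (iii) if the original order is valid and `S` is
itself an overlapping pair or loose cycle, the new order can be chosen to be valid. -/
theorem reorder_along_subhypergraph {V : Type*} [DecidableEq V] {k : ℕ} (hk : 3 ≤ k)
    (E : Finset (Finset V)) (hunif : Uniform k E) (hconn : HyperConnected E)
    (l : List (Finset V)) (hl : Allowed l) (hlE : l.toFinset = E)
    (i : ℕ) (hi0 : 0 < i) (hit : i < l.length)
    (hbad : 2 ≤ (oldOf l i).card)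
    (hfirst : ∀ j, 0 < j → j < i → GoodAt l j)
    (P : List (Finset V)) (hPsub : P.toFinset ⊆ (l.take (i + 1)).toFinset)
    (hPmem : l.getD i ∅ ∈ P)
    (hP : OverlapPair k P ∨ LooseCycle P) :
    (∀ S : Finset (Finset V), S ⊆ E → HyperConnected S → P.toFinset ⊆ S →
      ∃ r₁ r₂ : List (Finset V), Allowed (P ++ r₁ ++ r₂) ∧
        (P ++ r₁ ++ r₂).toFinset = E ∧ (P ++ r₁).toFinset = S) ∧
    (Valid k l → ∀ S : Finset (Finset V), S ⊆ E → HyperConnected S → P.toFinset ⊆ S →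
      (∃ s : List (Finset V), s.toFinset = S ∧ (OverlapPair k s ∨ LooseCycle s)) →
      ∃ r₁ r₂ : List (Finset V), Valid k (P ++ r₁ ++ r₂) ∧
        (P ++ r₁ ++ r₂).toFinset = E ∧ (P ++ r₁).toFinset = S) := by
  have hVP := valid_P hk hP
  have hPne : P ≠ [] := by rintro rfl; simp at hPmem
  rw [valid_iff] at hVP
  have hPord : OldOrd (fun n => 1 ≤ n) P := ord_mono (fun _ h => h.1) hVP.2
  refine ⟨?_, ?_⟩
  · intro S hSE hS hPS
    obtain ⟨r₁, a1, a2, a3⟩ := extend_conn S hS _ P rfl hPne hVP.1 hPord hPS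
    obtain ⟨r₂, b1, b2, b3⟩ := extend_conn E hconn _ (P ++ r₁) rfl (by simp [hPne]) a1 a2
      (by rw [a3]; exact hSE)
    exact ⟨r₁, r₂, (allowed_iff _).2 ⟨b1, b2⟩, b3, a3⟩
  · rintro hv S hSE hS hPS ⟨s, rfl, hs⟩
    have hPeq := P_eq_S hP hs hS hPS
    obtain ⟨c, rfl⟩ : ∃ c, k = c + 1 := ⟨k - 1, by omega⟩
    have hvi := (hv.2 i hi0 hit).2
    have hlnd := hl.1
    have hlc : ∀ x ∈ l, x.card = c + 1 := fun x hx => hunif x (by rw [← hlE]; simpa using hx)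
    rw [valid_iff] at hv
    set T := l.take i with hT
    set D := l.drop (i + 1) with hD
    set e := l.getD i ∅ with he
    have hsplit : l = T ++ e :: D := by
      rw [hT, hD, he, List.getD_eq_getElem _ _ hit]; simp
    have hold : oldOf l i = e ∩ vset T := rfl
    have htake : l.take (i + 1) = T ++ [e] := by
      rw [List.take_succ_eq_append_getElem hit, he, List.getD_eq_getElem _ _ hit]
    have hTne : T ≠ [] := by
      intro h0
      rw [hold, h0] at hbad
      simp [vset] at hbad
    have hTgood : OldOrd (fun n => n = 1) T := by
      rw [← ord_iff]
      intro j hj hjT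
      have hji : j < i := by
        rw [hT, List.length_take] at hjT; omega
      have hg := hfirst j hj hji
      have hjl : j < l.length := by omega
      unfold GoodAt oldOf at hg
      unfold oldOf
      rw [List.getD_eq_getElem _ _ hjT]
      rw [List.getD_eq_getElem _ _ hjl] at hg
      simpa [hT, List.take_take, Nat.min_eq_left hji.le] using hg
    have hTnd : (T ++ e :: D).Nodup := hsplit ▸ hlnd
    have heT : e ∉ T := by
      intro h
      exact (List.nodup_append.1 hTnd).2.2 e h e (by simp) rfl
    obtain ⟨A, hAne, hPA, hAord, heA⟩ := remove_P hP hPmem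
    have heAnd : (e :: A).Nodup := hPA.nodup_iff.1 hVP.1
    have hAT : A.toFinset ⊆ T.toFinset := by
      intro x hx
      have hxA : x ∈ A := by simpa using hx
      have hxP : x ∈ P := hPA.mem_iff.2 (by simp [hxA])
      have := hPsub (show x ∈ P.toFinset by simpa using hxP)
      rw [htake] at this
      simp only [List.mem_toFinset, List.mem_append, List.mem_singleton] at this ⊢
      rcases this with h | rfl
      · exact h
      · exact absurd hxA (List.nodup_cons.1 heAnd).1
    obtain ⟨r, r1, r2, r3⟩ := extend_conn T.toFinset
      (conn_of_ord (ord_mono (fun _ h => by omega) hTgood)) _ A rfl hAne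
      (List.nodup_cons.1 heAnd).2 hAord hAT
    have hperm : (A ++ r).Perm T :=
      List.perm_of_nodup_nodup_toFinset_eq r1 (List.nodup_append.1 hTnd).1 r3
    have hgood := all_good hperm.symm (fun x hx => hlc x (by rw [hsplit]; simp [hx])) hTgood r2
    have hpermPr : (P ++ r).Perm (T ++ [e]) :=
      (hPA.append_right r).trans ((hperm.cons e).trans (List.perm_append_comm (l₁ := [e])))
    have hpermL : (P ++ [] ++ (r ++ D)).Perm l := by
      rw [hsplit]
      have := hpermPr.append_right D
      simpa using this
    refine ⟨[], r ++ D, ?_, ?_, by simpa using hPeq⟩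
    · rw [valid_iff]
      refine ⟨hpermL.nodup_iff.2 hlnd, ?_⟩
      rw [List.append_nil, ← List.append_assoc, ord_append (by simp [hPne]), ord_append hPne]
      refine ⟨⟨hVP.2, ?_⟩, ?_⟩
      · intro a f b hab
        have hg := ((ord_append hAne).1 hgood).2 a f b hab
        have hfr : f ∈ r := by rw [hab]; simp
        have hfT : f ∈ T := hperm.mem_iff.1 (by simp [hfr])
        have hfc : f.card = c + 1 := hlc f (by rw [hsplit]; simp [hfT])
        have hVeq : vset (P ++ a) = e ∪ vset (A ++ a) := by
          rw [vset_append, vset_append, vset_congr (fun x => hPA.mem_iff),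
            show e :: A = [e] ++ A from rfl, vset_append, vset_single, Finset.union_assoc]
        rw [hVeq]
        constructor
        · have : f ∩ vset (A ++ a) ⊆ f ∩ (e ∪ vset (A ++ a)) :=
            Finset.inter_subset_inter_left Finset.subset_union_right
          have := Finset.card_le_card this
          omega
        · by_contra hcon
          have hfull : f ∩ (e ∪ vset (A ++ a)) = f :=
            Finset.eq_of_subset_of_card_le Finset.inter_subset_left (by omega)
          have hfsub : f \ vset (A ++ a) ⊆ e ∩ vset T := by
            intro v hvv
            rw [Finset.mem_sdiff] at hvv
            have : v ∈ f ∩ (e ∪ vset (A ++ a)) := by rw [hfull]; exact hvv.1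
            rw [Finset.mem_inter, Finset.mem_union] at this
            exact Finset.mem_inter.2 ⟨this.2.resolve_right hvv.2, mem_vset.2 ⟨f, hfT, hvv.1⟩⟩
          obtain ⟨x, hx⟩ := heA
          rw [Finset.mem_inter] at hx
          have hxn : x ∉ f \ vset (A ++ a) := by
            rw [Finset.mem_sdiff, vset_append, Finset.mem_union]
            tauto
          have hxT : x ∈ e ∩ vset T := by
            obtain ⟨y, hy, hxy⟩ := mem_vset.1 hx.2
            exact Finset.mem_inter.2 ⟨hx.1, mem_vset.2 ⟨y, hperm.mem_iff.1 (by simp [hy]), hxy⟩⟩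
          have hcard := Finset.card_le_card (Finset.insert_subset hxT hfsub)
          rw [Finset.card_insert_of_notMem hxn] at hcard
          have := Finset.card_sdiff_add_card_inter f (vset (A ++ a))
          rw [hold] at hvi
          omega
      · intro a f b hab
        have hv2 := hv.2 (T ++ e :: a) f b (by rw [hsplit, hab]; simp) (by simp)
        have : vset (P ++ r ++ a) = vset (T ++ e :: a) := by
          apply vset_congr
          intro x
          have := (hpermPr.append_right a).mem_iff (a := x)
          simpa using this
        rw [this]; exact hv2
    · rw [List.toFinset_eq_of_perm _ _ hpermL, hlE]
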